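/- arXiv:1311.5975 — 3 statements merged into one kernel-verified Lean document; each statement's English description precedes it below -/
import Mathlib

section
/- Let L ≥ 2 and α : ZMod L → ℝ be such that the values ω_i are pairwise distinct. If m¹ and m² are both threshold configurations, i.e. both minimize max_i ((Δm)_i + (Δα)_i) over m : ZMod L → ℤ, then there is an integer c with m²_i = m¹_i + c for all i; the threshold configuration is unique up to adding a constant integer to all well numbers. -/
/-- The periodic discrete Laplacian on integer sequences indexed by `ZMod L`. -/
def lapZ {L : ℕ} (v : ZMod L → ℤ) (i : ZMod L) : ℤ :=
  v (i - 1) - 2 * v i + v (i + 1)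

/-- The periodic discrete Laplacian on real sequences indexed by `ZMod L`. -/
def lapR {L : ℕ} (v : ZMod L → ℝ) (i : ZMod L) : ℝ :=
  v (i - 1) - 2 * v i + v (i + 1)

/-- Rescaled well coordinates of the toy CDW model: `z(m)_i = (Δm)_i + (Δα)_i`. -/
noncomputable def zco {L : ℕ} (α : ZMod L → ℝ) (m : ZMod L → ℤ) (i : ZMod L) : ℝ :=
  (lapZ m i : ℝ) + lapR α i

/-- `max_i z(m)_i` over the (finite, nonempty) set of sites. -/
noncomputable def zmax {L : ℕ} [NeZero L] (α : ZMod L → ℝ) (m : ZMod L → ℤ) : ℝ :=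
  Finset.univ.sup' ⟨0, Finset.mem_univ 0⟩ (zco α m)

/-- `ω_i = (Δα)_i − ⌊(Δα)_i⌉`, the fractional part of the Laplacian of the disorder. -/
noncomputable def omegaF {L : ℕ} (α : ZMod L → ℝ) (i : ZMod L) : ℝ :=
  lapR α i - round (lapR α i)

/-- A function on `ZMod L` with vanishing Laplacian is an arithmetic progression whose
common difference is killed by `L`. -/
theorem harmonic_eq_add_nsmul {L : ℕ} [NeZero L] {A : Type*} [AddCommGroup A] (g : ZMod L → A)
    (hg : ∀ i, g (i - 1) - 2 • g i + g (i + 1) = 0) :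
    L • (g 1 - g 0) = 0 ∧ ∀ i, g i = g 0 + i.val • (g 1 - g 0) := by
  have hstep : ∀ k : ℕ, g ((k : ZMod L) + 1) - g k = g 1 - g 0 := by
    intro k
    induction k with
    | zero => simp
    | succ k ih =>
      have h := hg ((k : ZMod L) + 1)
      rw [add_sub_cancel_right] at h
      rw [← ih, ← sub_eq_zero, ← h]
      push_cast
      abel
  have hk : ∀ k : ℕ, g k = g 0 + k • (g 1 - g 0) := by
    intro k
    induction k with
    | zero => simp
    | succ k ih =>
      rw [succ_nsmul, ← add_assoc, ← ih, ← hstep k]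
      push_cast
      abel
  refine ⟨?_, fun i => ?_⟩
  · have h := hk L
    rw [ZMod.natCast_self] at h
    exact left_eq_add.mp h
  · simpa using hk i.val

/-- Integer configurations with the same Laplacian differ by a constant. -/
theorem exists_eq_add_const_of_lapZ_eq {L : ℕ} [NeZero L] {v w : ZMod L → ℤ}
    (h : ∀ i, lapZ w i = lapZ v i) : ∃ c : ℤ, ∀ i, w i = v i + c := by
  obtain ⟨h0, hi⟩ := harmonic_eq_add_nsmul (fun i => w i - v i) (fun i => by
    have := h i
    simp only [lapZ] at this
    simp only [nsmul_eq_mul, Nat.cast_ofNat]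
    linarith)
  have hd := (smul_eq_zero.mp h0).resolve_left (NeZero.ne L)
  refine ⟨w 0 - v 0, fun i => ?_⟩
  have := hi i
  rw [hd, smul_zero] at this
  linarith

theorem sum_lapZ {L : ℕ} [NeZero L] (v : ZMod L → ℤ) : ∑ i, lapZ v i = 0 := by
  have h1 : ∑ i, v (i - 1) = ∑ i, v i := (Equiv.subRight (1 : ZMod L)).sum_comp v
  have h2 : ∑ i, v (i + 1) = ∑ i, v i := Equiv.sum_comp (Equiv.addRight (1 : ZMod L)) v
  simp only [lapZ, Finset.sum_add_distrib, Finset.sum_sub_distrib, ← Finset.mul_sum, h1, h2]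
  ring

theorem sum_mul_lapZ {L : ℕ} [NeZero L] (v : ZMod L → ℤ) :
    ∑ i : ZMod L, i * (lapZ v i : ZMod L) = 0 := by
  have h1 : ∑ i : ZMod L, i * (v (i - 1) : ZMod L) = ∑ i, (i + 1) * (v i : ZMod L) := by
    rw [← Equiv.sum_comp (Equiv.addRight (1 : ZMod L))]
    simp
  have h2 : ∑ i : ZMod L, i * (v (i + 1) : ZMod L) = ∑ i, (i - 1) * (v i : ZMod L) := by
    rw [← Equiv.sum_comp (Equiv.subRight (1 : ZMod L))]
    simp
  calc ∑ i : ZMod L, i * (lapZ v i : ZMod L)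
      = ∑ i : ZMod L, i * (v (i - 1) : ZMod L) - ∑ i, 2 * (i * (v i : ZMod L))
        + ∑ i : ZMod L, i * (v (i + 1) : ZMod L) := by
        rw [← Finset.sum_sub_distrib, ← Finset.sum_add_distrib]
        refine Finset.sum_congr rfl fun i _ => ?_
        simp only [lapZ]
        push_cast
        ring
    _ = 0 := by
        rw [h1, h2, ← Finset.sum_sub_distrib, ← Finset.sum_add_distrib]
        exact Finset.sum_eq_zero fun i _ => by ring

theorem sum_smul_of_forall_eq_add_nsmul {L : ℕ} [NeZero L] {A : Type*} [AddCommGroup A]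
    (f : ZMod L → ℤ) (g : ZMod L → A) (a b : A) (hg : ∀ i, g i = a + i.val • b) :
    ∑ i, f i • g i = (∑ i, f i) • a + (∑ i : ZMod L, f i * (i.val : ℤ)) • b := by
  rw [Finset.sum_smul, Finset.sum_smul, ← Finset.sum_add_distrib]
  refine Finset.sum_congr rfl fun i _ => ?_
  rw [hg i, smul_add, mul_smul, natCast_zsmul]

/-- An integer function on `ZMod L` of zero sum and zero first moment modulo `L` is the
Laplacian of an integer configuration. -/
theorem exists_lapZ_eq {L : ℕ} [NeZero L] (f : ZMod L → ℤ) (hsum : ∑ i, f i = 0)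
    (hmom : ∑ i : ZMod L, i * (f i : ZMod L) = 0) : ∃ v : ZMod L → ℤ, lapZ v = f := by
  let Δ : (ZMod L → ℤ) →+ (ZMod L → ℤ) :=
    { toFun := lapZ
      map_zero' := by ext; simp [lapZ]
      map_add' := fun v w => by ext; simp only [lapZ, Pi.add_apply]; ring }
  suffices f ∈ Δ.range from this
  let q := QuotientAddGroup.mk' Δ.range
  let g : ZMod L → (ZMod L → ℤ) ⧸ Δ.range := fun i => q (Pi.single i 1)
  obtain ⟨h0, hi⟩ := harmonic_eq_add_nsmul g (fun i => by
    simp only [g, ← map_nsmul, ← map_sub, ← map_add]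
    refine (QuotientAddGroup.eq_zero_iff _).mpr ⟨Pi.single i 1, ?_⟩
    ext j
    have e1 : j - 1 = i ↔ j = i + 1 := sub_eq_iff_eq_add
    have e2 : j + 1 = i ↔ j = i - 1 := eq_sub_iff_add_eq.symm
    simp only [Δ, AddMonoidHom.coe_mk, ZeroHom.coe_mk, lapZ, Pi.add_apply, Pi.sub_apply,
      two_nsmul, Pi.single_apply, e1, e2]
    ring)
  have hdvd : (L : ℤ) ∣ ∑ i : ZMod L, f i * (i.val : ℤ) := by
    rw [← ZMod.intCast_zmod_eq_zero_iff_dvd]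
    push_cast
    simpa [mul_comm] using hmom
  obtain ⟨k, hk⟩ := hdvd
  have hf : f = ∑ i, f i • Pi.single i (1 : ℤ) := by
    ext j
    simp [Finset.sum_apply, Pi.single_apply]
  refine (QuotientAddGroup.eq_zero_iff f).mp ?_
  change q f = 0
  calc q f = ∑ i, f i • g i := by
        conv_lhs => rw [hf]
        simp only [map_sum, map_zsmul, g]
    _ = (∑ i, f i) • g 0 + (∑ i : ZMod L, f i * (i.val : ℤ)) • (g 1 - g 0) :=
        sum_smul_of_forall_eq_add_nsmul f g _ _ hi
    _ = 0 := by
        rw [hsum, hk, mul_comm, mul_smul, natCast_zsmul, h0, zero_smul, smul_zero, add_zero]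

theorem exists_eq_single_of_sum_eq_one {ι : Type*} [Fintype ι] [DecidableEq ι] (s : ι → ℤ)
    (hs : ∀ i, 0 ≤ s i) (h : ∑ i, s i = 1) : ∃ j, s = Pi.single j 1 := by
  obtain ⟨j, -, hj⟩ : ∃ j ∈ Finset.univ, s j ≠ 0 :=
    Finset.exists_ne_zero_of_sum_ne_zero (by rw [h]; exact one_ne_zero)
  have ht : ∀ i ∈ Finset.univ, 0 ≤ s i - (Pi.single j 1 : ι → ℤ) i := by
    intro i _
    rw [Pi.single_apply]
    have := hs i
    split_ifs with hij
    · subst hij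
      omega
    · omega
  have h0 : ∑ i, (s i - (Pi.single j 1 : ι → ℤ) i) = 0 := by
    rw [Finset.sum_sub_distrib, h, Finset.sum_pi_single']
    simp
  refine ⟨j, funext fun i => ?_⟩
  exact sub_eq_zero.mp ((Finset.sum_eq_zero_iff_of_nonneg ht).mp h0 i (Finset.mem_univ i))

/-- Nonnegative integer functions on `ZMod L` of equal sum at most one and equal first moment
modulo `L` coincide. -/
theorem eq_of_sum_le_one_of_moment_eq {L : ℕ} [NeZero L] (s t : ZMod L → ℤ)
    (hs : ∀ i, 0 ≤ s i) (ht : ∀ i, 0 ≤ t i) (hst : ∑ i, s i = ∑ i, t i) (hle : ∑ i, s i ≤ 1)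
    (hmom : ∑ i : ZMod L, i * (s i : ZMod L) = ∑ i : ZMod L, i * (t i : ZMod L)) : s = t := by
  have h0 : 0 ≤ ∑ i, s i := Finset.sum_nonneg fun i _ => hs i
  obtain h | h : ∑ i, s i = 0 ∨ ∑ i, s i = 1 := by omega
  · have hs0 := (Finset.sum_eq_zero_iff_of_nonneg fun i _ => hs i).mp h
    have ht0 := (Finset.sum_eq_zero_iff_of_nonneg fun i _ => ht i).mp (hst ▸ h)
    ext i
    rw [hs0 i (Finset.mem_univ i), ht0 i (Finset.mem_univ i)]
  · obtain ⟨j, rfl⟩ := exists_eq_single_of_sum_eq_one s hs h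
    obtain ⟨k, rfl⟩ := exists_eq_single_of_sum_eq_one t ht (hst ▸ h)
    have : j = k := by simpa [Pi.single_apply] using hmom
    rw [this]

theorem eq_of_omegaF_injective {L : ℕ} {α : ZMod L → ℝ} (hdist : Function.Injective (omegaF α))
    {i j : ZMod L} {a b : ℤ} (h : a + lapR α i = b + lapR α j) : i = j := by
  apply hdist
  have hi : lapR α i = lapR α j + ((b - a : ℤ) : ℝ) := by
    push_cast
    linarith
  rw [omegaF, omegaF, hi, round_add_intCast]
  push_cast
  ring

/-- A function dominating the Laplacian of a threshold configuration, while keeping the well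
coordinates below the threshold, exceeds that Laplacian by at most one in total. -/
theorem sum_le_one_of_threshold {L : ℕ} [NeZero L] {α : ZMod L → ℝ}
    (hdist : Function.Injective (omegaF α)) {m : ZMod L → ℤ}
    (hm : ∀ m' : ZMod L → ℤ, zmax α m ≤ zmax α m') (u : ZMod L → ℤ)
    (hmu : ∀ i, lapZ m i ≤ u i) (hu : ∀ i, u i + lapR α i ≤ zmax α m) : ∑ i, u i ≤ 1 := by
  by_contra! hd
  obtain ⟨p, -, hp⟩ := Finset.exists_mem_eq_sup' Finset.univ_nonempty (zco α m)
  change zmax α m = zco α m p at hp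
  have hup : u p + lapR α p = zmax α m := by
    refine le_antisymm (hu p) ?_
    rw [hp, zco]
    gcongr
    exact hmu p
  let j : ZMod L := ∑ i : ZMod L, i * (u i : ZMod L) - p
  let d : ℤ := ∑ i, u i
  let f : ZMod L → ℤ := u - (Pi.single p 1 + Pi.single j 1 + Pi.single 0 (d - 2))
  obtain ⟨v, hv⟩ := exists_lapZ_eq f
    (by simp [f, Finset.sum_add_distrib, d])
    (by simp [f, mul_sub, mul_add, Finset.sum_add_distrib, Pi.single_apply, j])
  refine (hm v).not_gt ?_
  refine (Finset.sup'_lt_iff _).mpr fun i _ => ?_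
  have hs : ∀ (k : ZMod L) (c : ℤ), 0 ≤ c → 0 ≤ (Pi.single k c : ZMod L → ℤ) i :=
    fun k c hc => by rw [Pi.single_apply]; split_ifs <;> simp [hc]
  have hj := hs j 1 zero_le_one
  have h0 := hs 0 (d - 2) (by omega)
  rw [zco, hv]
  have hfi : f i = u i - ((Pi.single p 1 : ZMod L → ℤ) i + (Pi.single j 1 : ZMod L → ℤ) i
    + (Pi.single 0 (d - 2) : ZMod L → ℤ) i) := rfl
  by_cases hip : i = p
  · have hlt : f i < u i := by
      rw [hfi, hip, Pi.single_eq_same, ← hip]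
      omega
    have : (f i : ℝ) < u i := by exact_mod_cast hlt
    linarith [hu i]
  · have hle : f i ≤ u i := by
      have := hs p 1 zero_le_one
      omega
    have hfu : (f i : ℝ) ≤ u i := by exact_mod_cast hle
    have hne : u i + lapR α i ≠ zmax α m := fun h =>
      hip (eq_of_omegaF_injective hdist (h.trans hup.symm))
    linarith [lt_of_le_of_ne (hu i) hne]

/-- **Uniqueness of the toy-model threshold configuration up to a constant.**
If the `ω_i` are pairwise distinct and `m¹, m²` both minimize `max_i z(m)_i`, then
`m² = m¹ + c` for some constant integer `c`. -/
theorem toy_threshold_unique (L : ℕ) [NeZero L] (hL : 2 ≤ L) (α : ZMod L → ℝ)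
    (hdist : Function.Injective (omegaF α))
    (m1 m2 : ZMod L → ℤ)
    (h1 : ∀ m : ZMod L → ℤ, zmax α m1 ≤ zmax α m)
    (h2 : ∀ m : ZMod L → ℤ, zmax α m2 ≤ zmax α m) :
    ∃ c : ℤ, ∀ i : ZMod L, m2 i = m1 i + c := by
  have hM : zmax α m2 = zmax α m1 := le_antisymm (h2 m1) (h1 m2)
  let u : ZMod L → ℤ := fun i => ⌊zmax α m1 - lapR α i⌋
  have hle : ∀ m : ZMod L → ℤ, zmax α m = zmax α m1 → ∀ i, lapZ m i ≤ u i := by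
    intro m hm i
    have h : zco α m i ≤ zmax α m := Finset.le_sup' (zco α m) (Finset.mem_univ i)
    rw [hm, zco] at h
    exact Int.le_floor.mpr (by linarith)
  have hu : ∀ i, u i + lapR α i ≤ zmax α m1 := fun i => by
    linarith [Int.floor_le (zmax α m1 - lapR α i)]
  have hsum := sum_le_one_of_threshold hdist h1 u (hle m1 rfl) hu
  have hs : u - lapZ m1 = u - lapZ m2 := by
    apply eq_of_sum_le_one_of_moment_eq
    · exact fun i => sub_nonneg.mpr (hle m1 rfl i)
    · exact fun i => sub_nonneg.mpr (hle m2 hM i)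
    · simp [sum_lapZ]
    · simpa [sum_lapZ] using hsum
    · simp [mul_sub, sum_mul_lapZ]
  exact exists_eq_add_const_of_lapZ_eq fun i => (congrFun (sub_right_injective hs) i).symm
end

section
/- Let L ≥ 2 and α : ZMod L → ℝ with the ω_i pairwise distinct, let σ be the permutation of {0,…,L−1} ordering ω increasingly (ω_{σ(0)} < ⋯ < ω_{σ(L−1)}), and let m⁺, J, k⁺ be as in the explicit threshold construction. Then the minimum value z⁺_max = max_i ((Δm⁺)_i + (Δα)_i) equals: ω_{σ(S)} + 1 if S ≥ 0 and k⁺ ≠ σ(S); ω_{σ(S−1)} + 1 if S > 0 and k⁺ = σ(S); ω_{σ(L−1)} if S = 0 and k⁺ = σ(0); ω_{σ(L−|S|)} if S < 0 and k⁺ ≠ σ(L−|S|); and ω_{σ(L−|S|−1)} if S < 0 and k⁺ = σ(L−|S|). -/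
theorem omegaF_lt_half {L : ℕ} (α : ZMod L → ℝ) (i : ZMod L) : omegaF α i < 1 / 2 := by
  have h := Int.lt_floor_add_one (lapR α i + 1 / 2)
  rw [← round_eq] at h
  unfold omegaF
  linarith

theorem neg_half_le_omegaF {L : ℕ} (α : ZMod L → ℝ) (i : ZMod L) : -(1 / 2) ≤ omegaF α i := by
  have h := Int.floor_le (lapR α i + 1 / 2)
  rw [← round_eq] at h
  unfold omegaF
  linarith

theorem omegaF_lt_add_one {L : ℕ} (α : ZMod L → ℝ) (i j : ZMod L) :
    omegaF α i < omegaF α j + 1 := by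
  linarith [omegaF_lt_half α i, neg_half_le_omegaF α j]

theorem sum_lapR_eq_zero {L : ℕ} [NeZero L] (v : ZMod L → ℝ) : ∑ i, lapR v i = 0 := by
  have h₁ : ∑ i, v (i - 1) = ∑ i, v i := Equiv.sum_comp (Equiv.subRight (1 : ZMod L)) v
  have h₂ : ∑ i, v (i + 1) = ∑ i, v i := Equiv.sum_comp (Equiv.addRight (1 : ZMod L)) v
  simp only [lapR, Finset.sum_add_distrib, Finset.sum_sub_distrib, ← Finset.mul_sum, h₁, h₂]
  ring

/-- The rounded Laplacians cannot sum to `-L` or less. -/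
theorem neg_lt_sum_round_lapR {L : ℕ} [NeZero L] (α : ZMod L → ℝ) :
    -(L : ℤ) < ∑ i, round (lapR α i) := by
  have h₁ : ∑ i, omegaF α i < ∑ _i : ZMod L, (1 : ℝ) :=
    Finset.sum_lt_sum_of_nonempty ⟨0, Finset.mem_univ 0⟩
      fun i _ => by linarith [omegaF_lt_half α i]
  simp only [omegaF, Finset.sum_sub_distrib, sum_lapR_eq_zero, Finset.sum_const,
    Finset.card_univ, ZMod.card, nsmul_eq_mul, mul_one] at h₁
  have h₂ : (-(L : ℤ) : ℝ) < ((∑ i, round (lapR α i) : ℤ) : ℝ) := by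
    push_cast
    linarith
  exact_mod_cast h₂

theorem card_filter_lt_of_strictMono {n : ℕ} {ι : Type*} [Fintype ι] (σ : Fin n ≃ ι) {f : ι → ℝ}
    (hσ : StrictMono fun s => f (σ s)) (s : Fin n) [DecidablePred fun j => f j < f (σ s)] :
    (Finset.univ.filter fun j => f j < f (σ s)).card = s := by
  rw [← Fin.card_Iio s, ← Finset.card_map σ.toEmbedding]
  congr 1
  ext j
  obtain ⟨t, rfl⟩ := σ.surjective j
  simp [hσ.lt_iff_lt (a := t) (b := s)]

theorem card_filter_gt_of_strictMono {n : ℕ} {ι : Type*} [Fintype ι] (σ : Fin n ≃ ι) {f : ι → ℝ}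
    (hσ : StrictMono fun s => f (σ s)) (s : Fin n) [DecidablePred fun j => f (σ s) < f j] :
    (Finset.univ.filter fun j => f (σ s) < f j).card = n - 1 - s := by
  rw [← Fin.card_Ioi s, ← Finset.card_map σ.toEmbedding]
  congr 1
  ext j
  obtain ⟨t, rfl⟩ := σ.surjective j
  simp [hσ.lt_iff_lt (a := s) (b := t)]

theorem zmax_eq_of_attained {L : ℕ} [NeZero L] {α : ZMod L → ℝ} {m : ZMod L → ℤ} {c : ℝ}
    (σ : Fin L ≃ ZMod L) (t : Fin L) (ht : zco α m (σ t) = c)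
    (hle : ∀ s, zco α m (σ s) ≤ c) : zmax α m = c := by
  refine le_antisymm (Finset.sup'_le _ _ fun i _ => ?_) ?_
  · simpa using hle (σ.symm i)
  · exact ht ▸ Finset.le_sup' (zco α m) (Finset.mem_univ (σ t))


open Classical in
/-- **The threshold maximum `z⁺_max` (Corollary 4.2).**
Let `σ` order the `ω_i` increasingly and let `m⁺, J, k⁺` be the explicit threshold
construction.  Then `z⁺_max = max_i ((Δm⁺)_i + (Δα)_i)` is given by the five-case
formula of the corollary. -/
theorem toy_threshold_max (L : ℕ) [NeZero L] (hL : 2 ≤ L) (α : ZMod L → ℝ)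
    (hdist : Function.Injective (omegaF α))
    (S : ℤ) (hS : S = ∑ i : ZMod L, round (lapR α i))
    (J : ZMod L → ℤ)
    (hJpos : 0 ≤ S → ∀ i : ZMod L, J i =
      if ((Finset.univ.filter fun j => omegaF α j < omegaF α i).card : ℤ) < S + 1
      then 1 else 0)
    (hJneg : S < 0 → ∀ i : ZMod L, J i =
      if ((Finset.univ.filter fun j => omegaF α i < omegaF α j).card : ℤ) < |S| - 1
      then -1 else 0)
    (kplus : ZMod L)
    (hk : kplus = ((∑ i : ZMod L, (i.val : ℤ) * (-(round (lapR α i)) + J i) : ℤ) : ZMod L))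
    (mplus : ZMod L → ℤ)
    (hm : ∀ i : ZMod L, lapZ mplus i =
      -(round (lapR α i)) + J i - if i = kplus then 1 else 0)
    (σ : Fin L ≃ ZMod L)
    (hσ : StrictMono fun s : Fin L => omegaF α (σ s)) :
    (∀ (hS0 : 0 ≤ S) (h1 : S.toNat < L), kplus ≠ σ ⟨S.toNat, h1⟩ →
      zmax α mplus = omegaF α (σ ⟨S.toNat, h1⟩) + 1) ∧
    (∀ (hS0 : 0 < S) (h1 : S.toNat < L), kplus = σ ⟨S.toNat, h1⟩ →
      zmax α mplus = omegaF α (σ ⟨S.toNat - 1, by omega⟩) + 1) ∧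
    (S = 0 → kplus = σ ⟨0, by omega⟩ →
      zmax α mplus = omegaF α (σ ⟨L - 1, by omega⟩)) ∧
    (∀ (hS0 : S < 0), kplus ≠ σ ⟨L - S.natAbs, by omega⟩ →
      zmax α mplus = omegaF α (σ ⟨L - S.natAbs, by omega⟩)) ∧
    (∀ (hS0 : S < 0), kplus = σ ⟨L - S.natAbs, by omega⟩ →
      zmax α mplus = omegaF α (σ ⟨L - S.natAbs - 1, by omega⟩)) := by
  have hSL : -(L : ℤ) < S := hS ▸ neg_lt_sum_round_lapR α
  have hJ₀ (h : 0 ≤ S) (s : Fin L) : J (σ s) = if (s : ℕ) ≤ S.toNat then 1 else 0 := by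
    rw [hJpos h, card_filter_lt_of_strictMono σ hσ s]
    exact if_congr (by omega) rfl rfl
  have hJ₁ (h : S < 0) (s : Fin L) :
      J (σ s) = if L - S.natAbs < (s : ℕ) then -1 else 0 := by
    rw [hJneg h, card_filter_gt_of_strictMono σ hσ s]
    exact if_congr (by have := s.isLt; rw [abs_of_neg h]; omega) rfl rfl
  have hz (i : ZMod L) : zco α mplus i = omegaF α i + J i - if i = kplus then 1 else 0 := by
    simp only [zco, hm, omegaF]
    push_cast
    ring
  have hlt (s t : Fin L) : omegaF α (σ s) < omegaF α (σ t) + 1 := omegaF_lt_add_one α _ _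
  have hle {s t : Fin L} (h : (s : ℕ) ≤ t) : omegaF α (σ s) ≤ omegaF α (σ t) :=
    hσ.monotone h
  refine ⟨fun hS0 h1 hk' => ?_, fun hS0 h1 hk' => ?_, fun hS0 hk' => ?_, fun hS0 hk' => ?_,
    fun hS0 hk' => ?_⟩
  · refine zmax_eq_of_attained σ ⟨S.toNat, h1⟩ ?_ fun s => ?_
    · rw [hz, hJ₀ hS0, if_pos le_rfl, if_neg hk'.symm]
      simp
    · rw [hz, hJ₀ hS0]
      have h₁ := hlt s ⟨S.toNat, h1⟩
      have h₂ := @hle s ⟨S.toNat, h1⟩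
      split_ifs with h <;> first | (have := h₂ h; push_cast; linarith) | (push_cast; linarith)
  · refine zmax_eq_of_attained σ ⟨S.toNat - 1, by omega⟩ ?_ fun s => ?_
    · rw [hz, hJ₀ hS0.le, if_pos (by simp), if_neg]
      · simp
      · rw [hk', σ.injective.eq_iff, Fin.mk.injEq]
        omega
    · rw [hz, hJ₀ hS0.le, hk']
      simp only [σ.injective.eq_iff, Fin.ext_iff]
      have h₁ := hlt s ⟨S.toNat - 1, by omega⟩
      have h₂ := @hle s ⟨S.toNat - 1, by omega⟩
      dsimp only at h₂
      split_ifs with h h' <;>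
        first | (have := h₂ (by omega); push_cast; linarith) | (push_cast; linarith)
  · have hzω (s : Fin L) : zco α mplus (σ s) = omegaF α (σ s) := by
      rw [hz, hJ₀ hS0.ge, hk']
      simp only [σ.injective.eq_iff, Fin.ext_iff]
      split_ifs <;> first | omega | simp
    refine zmax_eq_of_attained σ ⟨L - 1, by omega⟩ (hzω _) fun s => ?_
    rw [hzω]
    exact hle (Nat.le_sub_one_of_lt s.isLt)
  · refine zmax_eq_of_attained σ ⟨L - S.natAbs, by omega⟩ ?_ fun s => ?_
    · rw [hz, hJ₁ hS0, if_neg (by simp), if_neg hk'.symm]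
      simp
    · rw [hz, hJ₁ hS0]
      have h₁ := hlt s ⟨L - S.natAbs, by omega⟩
      have h₂ := @hle s ⟨L - S.natAbs, by omega⟩
      dsimp only at h₂
      split_ifs with h <;>
        first | (have := h₂ (by omega); push_cast; linarith) | (push_cast; linarith)
  · refine zmax_eq_of_attained σ ⟨L - S.natAbs - 1, by omega⟩ ?_ fun s => ?_
    · rw [hz, hJ₁ hS0, if_neg (by dsimp only; omega), if_neg]
      · simp
      · rw [hk', σ.injective.eq_iff, Fin.mk.injEq]
        omega
    · rw [hz, hJ₁ hS0, hk']
      simp only [σ.injective.eq_iff, Fin.ext_iff]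
      have h₁ := hlt s ⟨L - S.natAbs - 1, by omega⟩
      have h₂ := @hle s ⟨L - S.natAbs - 1, by omega⟩
      dsimp only at h₂
      split_ifs with h h' <;>
        first | (have := h₂ (by omega); push_cast; linarith) | (push_cast; linarith)
end

section
/- Let L ≥ 1 and α : ZMod L → ℝ with the ω_i pairwise distinct (so that at every stage the maximizing site of z is unique and the ZFA result is a well-defined map m ↦ ZFA(m)). Let m¹, m² : ZMod L → ℤ with m¹_i ≤ m²_i for all i. Then: (i) if max_i z(m¹)_i > max_i z(m²)_i, then ZFA(m¹)_i ≤ m²_i for all i; (ii) if max_i z(m¹)_i = max_i z(m²)_i and m¹_j < m²_j for the site j attaining max_i z(m¹)_i, then ZFA(m¹)_i ≤ m²_i for all i; (iii) if max_i z(m¹)_i ≥ max_i z(m²)_i, then ZFA(m¹)_i ≤ ZFA(m²)_i for all i. -/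
/-- Toppling site `j`: increment the well number at `j` by one. -/
def topple {L : ℕ} (m : ZMod L → ℤ) (j : ZMod L) : ZMod L → ℤ :=
  fun i => m i + if i = j then 1 else 0

/-- A run of the zero-force avalanche algorithm (ZFA) starting from `m0`, with record
`M = max_i z(m0)_i`: the sequence `m0 = ms 0, ms 1, …, ms N` in which `ms (k+1)` is
obtained from `ms k` by toppling the site `js k`; `js 0` attains `max_i z(ms 0)_i`;
for `1 ≤ k < N` the site `js k` attains `max_i z(ms k)_i` and satisfies
`z(ms k)_{js k} > M`; and `N` is the first index `≥ 1` with `max_i z(ms N)_i ≤ M`. -/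
def IsZFARun {L : ℕ} [NeZero L] (α : ZMod L → ℝ) (m0 : ZMod L → ℤ)
    (N : ℕ) (ms : ℕ → ZMod L → ℤ) (js : ℕ → ZMod L) : Prop :=
  ms 0 = m0 ∧ 1 ≤ N ∧
  (∀ k < N, ms (k + 1) = topple (ms k) (js k)) ∧
  (∀ k < N, ∀ i : ZMod L, zco α (ms k) i ≤ zco α (ms k) (js k)) ∧
  (∀ k, 1 ≤ k → k < N → zmax α m0 < zco α (ms k) (js k)) ∧
  zmax α (ms N) ≤ zmax α m0 ∧
  (∀ k, 1 ≤ k → k < N → zmax α m0 < zmax α (ms k))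

/-- The coordinate at `j` is monotone in the configuration when the value at `j` is fixed. -/
theorem zco_le_of_le_of_eq {L : ℕ} (α : ZMod L → ℝ) {m b : ZMod L → ℤ} {j : ZMod L}
    (hle : ∀ i, m i ≤ b i) (hj : m j = b j) : zco α m j ≤ zco α b j := by
  have h : lapZ m j ≤ lapZ b j := by
    unfold lapZ
    linarith [hle (j - 1), hle (j + 1)]
  unfold zco
  gcongr

theorem zco_le_zmax {L : ℕ} [NeZero L] (α : ZMod L → ℝ) (m : ZMod L → ℤ) (j : ZMod L) :
    zco α m j ≤ zmax α m :=
  Finset.le_sup' (zco α m) (Finset.mem_univ j)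

theorem zmax_eq_of_isMax {L : ℕ} [NeZero L] {α : ZMod L → ℝ} {m : ZMod L → ℤ} {j : ZMod L}
    (hj : ∀ i, zco α m i ≤ zco α m j) : zmax α m = zco α m j :=
  le_antisymm (Finset.sup'_le _ _ fun i _ => hj i) (zco_le_zmax α m j)

/-- Distinct `ω_i` force the coordinates of a configuration to be distinct. -/
theorem zco_injective {L : ℕ} {α : ZMod L → ℝ} (hdist : Function.Injective (omegaF α))
    (m : ZMod L → ℤ) : Function.Injective (zco α m) := by
  intro i j hij
  apply hdist
  have h : lapR α i = lapR α j + ((lapZ m j - lapZ m i : ℤ) : ℝ) := by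
    unfold zco at hij
    push_cast
    linarith
  unfold omegaF
  rw [h, round_add_intCast]
  push_cast
  ring

theorem topple_le_of_lt {L : ℕ} {m b : ZMod L → ℤ} {j : ZMod L}
    (hle : ∀ i, m i ≤ b i) (hj : m j < b j) (i : ZMod L) : topple m j i ≤ b i := by
  unfold topple
  split_ifs with h
  · subst h
    omega
  · simpa using hle i

theorem le_topple {L : ℕ} (m : ZMod L → ℤ) (j i : ZMod L) : m i ≤ topple m j i := by
  unfold topple
  split_ifs <;> omega

namespace IsZFARun

variable {L : ℕ} [NeZero L] {α : ZMod L → ℝ} {m : ZMod L → ℤ} {N : ℕ}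
  {ms : ℕ → ZMod L → ℤ} {js : ℕ → ZMod L}

theorem first_step (h : IsZFARun α m N ms js) : ms 1 = topple m (js 0) := by
  obtain ⟨h0, hN, hstep, -⟩ := h
  rw [← h0]
  exact hstep 0 hN

theorem zco_le_first (h : IsZFARun α m N ms js) (i : ZMod L) :
    zco α m i ≤ zco α m (js 0) := by
  obtain ⟨h0, hN, -, hmax, -⟩ := h
  rw [← h0]
  exact hmax 0 hN i

theorem le_final (h : IsZFARun α m N ms js) {k : ℕ} (hk : k ≤ N) (i : ZMod L) :
    ms k i ≤ ms N i := by
  obtain ⟨-, -, hstep, -⟩ := h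
  induction hk using Nat.decreasingInduction with
  | self => exact le_rfl
  | of_succ k hk ih =>
    rw [hstep k hk] at ih
    exact (le_topple _ _ _).trans ih

/-- A configuration whose maximum does not exceed the record is a barrier for the run after
its first step. -/
theorem final_le (h : IsZFARun α m N ms js) {b : ZMod L → ℤ} (hb : zmax α b ≤ zmax α m)
    (hfirst : ∀ i, topple m (js 0) i ≤ b i) : ∀ i, ms N i ≤ b i := by
  have h1 := h.first_step
  obtain ⟨-, hN, hstep, -, hrec, -⟩ := h
  induction N, hN using Nat.le_induction with
  | base => rwa [h1]
  | succ k hk ih =>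
    have hle : ∀ i, ms k i ≤ b i :=
      ih (fun l hl => hstep l (by omega)) (fun l hl hl' => hrec l hl (by omega))
    rw [hstep k (by omega)]
    refine topple_le_of_lt hle (lt_of_le_of_ne (hle _) fun heq => ?_)
    exact absurd (hrec k hk (by omega)) (not_lt.mpr
      ((zco_le_of_le_of_eq α hle heq).trans ((zco_le_zmax α b _).trans hb)))

end IsZFARun

/-- **ZFA noncrossing (Lemma 3.4).**  Suppose the `ω_i` are pairwise distinct, and let
`m¹ ≤ m²` be configurations with ZFA runs ending in `ZFA(m¹) = ms1 N1` and
`ZFA(m²) = ms2 N2`.  Then (i) if `max z(m¹) > max z(m²)` then `ZFA(m¹) ≤ m²`;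
(ii) if `max z(m¹) = max z(m²)` and `m¹_j < m²_j` at the maximizing site `j` of `z(m¹)`,
then `ZFA(m¹) ≤ m²`; (iii) if `max z(m¹) ≥ max z(m²)` then `ZFA(m¹) ≤ ZFA(m²)`. -/
theorem zfa_noncrossing (L : ℕ) [NeZero L] (α : ZMod L → ℝ)
    (hdist : Function.Injective (omegaF α))
    (m1 m2 : ZMod L → ℤ) (hle : ∀ i : ZMod L, m1 i ≤ m2 i)
    (N1 : ℕ) (ms1 : ℕ → ZMod L → ℤ) (js1 : ℕ → ZMod L)
    (h1 : IsZFARun α m1 N1 ms1 js1)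
    (N2 : ℕ) (ms2 : ℕ → ZMod L → ℤ) (js2 : ℕ → ZMod L)
    (h2 : IsZFARun α m2 N2 ms2 js2) :
    (zmax α m2 < zmax α m1 → ∀ i : ZMod L, ms1 N1 i ≤ m2 i) ∧
    ((zmax α m1 = zmax α m2 ∧
        ∀ j : ZMod L, (∀ i : ZMod L, zco α m1 i ≤ zco α m1 j) → m1 j < m2 j) →
      ∀ i : ZMod L, ms1 N1 i ≤ m2 i) ∧
    (zmax α m2 ≤ zmax α m1 → ∀ i : ZMod L, ms1 N1 i ≤ ms2 N2 i) := by
  have hmax1 := zmax_eq_of_isMax h1.zco_le_first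
  have key : zmax α m2 ≤ zmax α m1 → m1 (js1 0) < m2 (js1 0) → ∀ i, ms1 N1 i ≤ m2 i :=
    fun hM hj => h1.final_le hM (topple_le_of_lt hle hj)
  refine ⟨fun hM => key hM.le (lt_of_le_of_ne (hle _) fun heq => ?_),
    fun ⟨hM, hj⟩ => key hM.ge (hj _ h1.zco_le_first), fun hM => ?_⟩
  · have := zco_le_of_le_of_eq α hle heq
    linarith [zco_le_zmax α m2 (js1 0)]
  · rcases (hle (js1 0)).lt_or_eq with hj | heq
    · intro i
      have hstart := h2.le_final (Nat.zero_le N2) i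
      rw [h2.1] at hstart
      exact (key hM hj i).trans hstart
    · have hz := zco_le_of_le_of_eq α hle heq
      have hmax2 := zmax_eq_of_isMax h2.zco_le_first
      have hsite : js1 0 = js2 0 := zco_injective hdist m2 <|
        le_antisymm (h2.zco_le_first _) (by linarith)
      refine h1.final_le (h2.2.2.2.2.2.1.trans hM) fun i => ?_
      refine le_trans ?_ (h2.le_final h2.2.1 i)
      rw [h2.first_step, hsite]
      unfold topple
      linarith [hle i]
end
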